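/- (One adaptation step of ARPSD.) Assume f : ℝⁿ → ℝ is differentiable, μ-strongly convex and L-smooth, g is convex, proper, lower semicontinuous, γ ∈ (0, 2/(μ+L)], and x* minimizes f + g over ℝⁿ. Let 𝖯₁ and 𝖯₂ be symmetric positive definite matrices with inverse square roots Q₁ = 𝖯₁^{-1/2} and Q₂ = 𝖯₂^{-1/2}, let λ > 0 satisfy λ‖v‖² ≤ ⟨v, 𝖯₁v⟩ for all v, and set z*₁ = Q₁(x* − γ∇f(x*)) and z*₂ = Q₂(x* − γ∇f(x*)). Let R be an integrable random orthogonal projection with E[R] = 𝖯₁. For any z ∈ ℝⁿ, let x be the proximal point prox_{γg}(Q₁⁻¹z) and y = Q₁(x − γ∇f(x)). Then E[‖Q₂Q₁⁻¹(z + R(y − z)) − z*₂‖²] ≤ ‖Q₂Q₁⁻¹‖² · (1 − λ · 2γμL/(μ+L)) · ‖z − z*₁‖², where ‖Q₂Q₁⁻¹‖ denotes the operator (spectral) norm. -/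

import Mathlib

open MeasureTheory
open scoped RealInnerProductSpace

lemma aux_slope {ψ : ℝ → ℝ} {d c K : ℝ} (h : HasDerivAt ψ d 0)
    (hb : ∀ t, 0 < t → t ≤ 1 → ψ t ≤ ψ 0 + t * c + K * t ^ 2) : d ≤ c := by
  have h1 : Filter.Tendsto (slope ψ 0) (nhdsWithin 0 (Set.Ioi 0)) (nhds d) :=
    (hasDerivAt_iff_tendsto_slope.mp h).mono_left
      (nhdsWithin_mono _ (fun t ht => ne_of_gt ht))
  have h2 : Filter.Tendsto (fun t : ℝ => c + K * t) (nhdsWithin 0 (Set.Ioi 0)) (nhds c) := by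
    have : Filter.Tendsto (fun t : ℝ => c + K * t) (nhds 0) (nhds (c + K * 0)) :=
      Continuous.tendsto (by fun_prop) 0
    simpa using this.mono_left nhdsWithin_le_nhds
  refine le_of_tendsto_of_tendsto h1 h2 ?_
  filter_upwards [Ioc_mem_nhdsGT (zero_lt_one' ℝ)] with t ht
  have := hb t ht.1 ht.2
  rw [slope_def_field, sub_zero, div_le_iff₀ ht.1]
  nlinarith

section
variable {E : Type*} [NormedAddCommGroup E] [InnerProductSpace ℝ E] [CompleteSpace E]

lemma aux_line {f : E → ℝ} {x e p : E} {t : ℝ} (h : HasGradientAt f p (x + t • e)) :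
    HasDerivAt (fun s : ℝ => f (x + s • e)) ⟪p, e⟫ t := by
  have h1 : HasDerivAt (fun s : ℝ => x + s • e) e t := by
    simpa using ((hasDerivAt_id t).smul_const e).const_add x
  have h2 := h.hasFDerivAt.comp_hasDerivAt t h1
  simpa [Function.comp_def] using h2

lemma aux_sc {f : E → ℝ} {f' : E → E} {m : ℝ} (hgrad : ∀ x, HasGradientAt f (f' x) x)
    (hsc : StrongConvexOn Set.univ m f) (x y : E) :
    f x + ⟪f' x, y - x⟫ + m / 2 * ‖y - x‖ ^ 2 ≤ f y := by
  have h := aux_line (f := f) (x := x) (e := y - x) (t := 0) (by simpa using hgrad x)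
  have := aux_slope (c := f y - f x - m / 2 * ‖y - x‖ ^ 2) (K := m / 2 * ‖y - x‖ ^ 2) h ?_
  · linarith
  intro t ht ht1
  have h3 := hsc.2 (Set.mem_univ x) (Set.mem_univ y) (sub_nonneg.mpr ht1) ht.le (by ring)
  have h4 : (1 - t) • x + t • y = x + t • (y - x) := by module
  rw [h4, norm_sub_rev x y] at h3
  simp only [smul_eq_mul] at h3
  simp only [zero_smul, add_zero]
  nlinarith

lemma aux_descent {f : E → ℝ} {f' : E → E} {L : ℝ} (hgrad : ∀ x, HasGradientAt f (f' x) x)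
    (hs : ∀ x y, ‖f' x - f' y‖ ≤ L * ‖x - y‖) (x y : E) :
    f y ≤ f x + ⟪f' x, y - x⟫ + L / 2 * ‖y - x‖ ^ 2 := by
  set e := y - x with he
  have hd : ∀ t : ℝ, HasDerivAt
      (fun s : ℝ => f (x + s • e) - s * ⟪f' x, e⟫ - L / 2 * ‖e‖ ^ 2 * s ^ 2)
      (⟪f' (x + t • e), e⟫ - 1 * ⟪f' x, e⟫ - L / 2 * ‖e‖ ^ 2 * ((2 : ℕ) * t ^ (2 - 1))) t := by
    intro t
    exact ((aux_line (hgrad _)).sub ((hasDerivAt_id t).mul_const _)).sub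
      ((hasDerivAt_pow 2 t).const_mul _)
  have hanti := antitoneOn_of_deriv_nonpos (convex_Icc (0 : ℝ) 1)
    (fun t _ => (hd t).continuousAt.continuousWithinAt)
    (fun t _ => (hd t).differentiableAt.differentiableWithinAt)
    (by
      intro t ht
      rw [interior_Icc] at ht
      rw [(hd t).deriv]
      have h1 := real_inner_le_norm (f' (x + t • e) - f' x) e
      have h2 := hs (x + t • e) x
      rw [add_sub_cancel_left, norm_smul, Real.norm_of_nonneg ht.1.le] at h2
      have h3 := mul_le_mul_of_nonneg_right h2 (norm_nonneg e)
      rw [inner_sub_left] at h1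
      norm_num
      nlinarith)
  have := hanti (Set.left_mem_Icc.mpr zero_le_one) (Set.right_mem_Icc.mpr zero_le_one) zero_le_one
  have hy : x + e = y := by rw [he]; abel
  simp [hy] at this
  linarith

lemma aux_coco1 {f : E → ℝ} {f' : E → E} {m L : ℝ} (hgrad : ∀ x, HasGradientAt f (f' x) x)
    (hsc : StrongConvexOn Set.univ m f)
    (hs : ∀ x y, ‖f' x - f' y‖ ≤ L * ‖x - y‖) (x y : E) (t : ℝ) :
    f x + ⟪f' x, y - x⟫ + m / 2 * ‖y - x‖ ^ 2 +
      (t - (L - m) / 2 * t ^ 2) * ‖f' y - f' x - m • (y - x)‖ ^ 2 ≤ f y := by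
  set d := f' y - f' x - m • (y - x) with hd
  have h1 := aux_sc hgrad hsc x (y - t • d)
  have h2 := aux_descent hgrad hs y (y - t • d)
  have e1 : y - t • d - x = (y - x) - t • d := by abel
  have e2 : y - t • d - y = - (t • d) := by abel
  have hfy : f' y = f' x + d + m • (y - x) := by rw [hd]; abel
  rw [e1] at h1
  rw [e2, hfy] at h2
  set e := y - x
  rw [norm_neg, norm_smul, mul_pow, Real.norm_eq_abs, sq_abs] at h2
  rw [norm_sub_sq_real, norm_smul, mul_pow, Real.norm_eq_abs, sq_abs] at h1
  simp only [inner_sub_right, inner_neg_right, inner_add_left, inner_smul_left, inner_smul_right,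
    real_inner_self_eq_norm_sq, conj_trivial] at h1 h2
  nlinarith

lemma aux_coco {f : E → ℝ} {f' : E → E} {m L : ℝ} (hmL : m ≤ L)
    (hgrad : ∀ x, HasGradientAt f (f' x) x)
    (hsc : StrongConvexOn Set.univ m f)
    (hs : ∀ x y, ‖f' x - f' y‖ ≤ L * ‖x - y‖) (x y : E) :
    ‖f' x - f' y‖ ^ 2 + m * L * ‖x - y‖ ^ 2 ≤ (m + L) * ⟪f' x - f' y, x - y⟫ := by
  have key : ∀ t : ℝ, (2 * t - (L - m) * t ^ 2) * ‖f' x - f' y - m • (x - y)‖ ^ 2 ≤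
      ⟪f' x - f' y - m • (x - y), x - y⟫ := by
    intro t
    have h1 := aux_coco1 hgrad hsc hs x y t
    have h2 := aux_coco1 hgrad hsc hs y x t
    have e1 : f' y - f' x - m • (y - x) = - (f' x - f' y - m • (x - y)) := by module
    have e2 : y - x = - (x - y) := by abel
    rw [e1, e2, norm_neg, norm_neg, inner_neg_right] at h1
    have e3 : ⟪f' x - f' y - m • (x - y), x - y⟫ =
      ⟪f' x, x - y⟫ - ⟪f' y, x - y⟫ - m * ‖x - y‖ ^ 2 := by
      rw [inner_sub_left, inner_sub_left, real_inner_smul_left, real_inner_self_eq_norm_sq]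
    rw [e3]
    nlinarith
  have key2 : ‖f' x - f' y - m • (x - y)‖ ^ 2 ≤
      (L - m) * ⟪f' x - f' y - m • (x - y), x - y⟫ := by
    set D := ‖f' x - f' y - m • (x - y)‖ ^ 2 with hD
    set I := ⟪f' x - f' y - m • (x - y), x - y⟫
    rcases hmL.eq_or_lt with h | h
    · subst h
      by_contra hc
      have hc' : 0 < D := by simpa using hc
      have := key ((I + 1) / (2 * D))
      have e : (2 * ((I + 1) / (2 * D)) - (m - m) * ((I + 1) / (2 * D)) ^ 2) * D = I + 1 := by
        field_simp; ring
      linarith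
    · have hM : 0 < L - m := sub_pos.mpr h
      have := mul_le_mul_of_nonneg_left (key (1 / (L - m))) hM.le
      have e : (L - m) * ((2 * (1 / (L - m)) - (L - m) * (1 / (L - m)) ^ 2) * D) = D := by
        field_simp; ring
      linarith
  rw [norm_sub_sq_real, norm_smul, mul_pow, Real.norm_eq_abs, sq_abs,
    inner_sub_left (f' x - f' y), real_inner_smul_left, real_inner_smul_right, real_inner_self_eq_norm_sq] at key2
  nlinarith

lemma aux_contr {f : E → ℝ} {f' : E → E} {m L γ : ℝ} (hm : 0 < m) (hmL : m ≤ L)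
    (hγ0 : 0 < γ) (hγ : γ ≤ 2 / (m + L))
    (hgrad : ∀ x, HasGradientAt f (f' x) x)
    (hsc : StrongConvexOn Set.univ m f)
    (hs : ∀ x y, ‖f' x - f' y‖ ≤ L * ‖x - y‖) (x y : E) :
    ‖(x - γ • f' x) - (y - γ • f' y)‖ ^ 2 ≤
      (1 - 2 * γ * m * L / (m + L)) * ‖x - y‖ ^ 2 := by
  have h := aux_coco hmL hgrad hsc hs x y
  have hS : 0 < m + L := by linarith
  have e : (x - γ • f' x) - (y - γ • f' y) = (x - y) - γ • (f' x - f' y) := by module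
  rw [e, norm_sub_sq_real, norm_smul, mul_pow, Real.norm_eq_abs, sq_abs, real_inner_smul_right,
    real_inner_comm]
  set G := ‖f' x - f' y‖ ^ 2 with hG
  have hG0 : 0 ≤ G := by positivity
  set I := ⟪f' x - f' y, x - y⟫
  set N := ‖x - y‖ ^ 2
  have hI : (G + m * L * N) / (m + L) ≤ I := by
    rw [div_le_iff₀ hS]; linarith
  have e2 : (1 - 2 * γ * m * L / (m + L)) * N =
      N - 2 * γ * ((G + m * L * N) / (m + L)) + γ * (2 / (m + L)) * G := by
    field_simp; ring
  rw [e2]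
  have h1 := mul_le_mul_of_nonneg_left hI (by positivity : 0 ≤ 2 * γ)
  have h2 := mul_le_mul_of_nonneg_right (mul_le_mul_of_nonneg_left hγ hγ0.le) hG0
  nlinarith

/-- First-order optimality for a smooth plus convex sum. -/
lemma aux_opt {φ : E → ℝ} {g : E → EReal} {x p : E} (hφ : HasGradientAt φ p x)
    (hg_conv : ∀ x y : E, ∀ a b : ℝ, 0 ≤ a → 0 ≤ b → a + b = 1 →
      g (a • x + b • y) ≤ (a : EReal) * g x + (b : EReal) * g y)
    (hg_ne_bot : ∀ x, g x ≠ ⊥) (hx : g x ≠ ⊤)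
    (hmin : ∀ v, (φ x : EReal) + g x ≤ φ v + g v) (v : E) (hv : g v ≠ ⊤) :
    (g x).toReal ≤ (g v).toReal + ⟪p, v - x⟫ := by
  have h := (aux_line (f := φ) (x := x) (e := v - x) (t := 0) (by simpa using hφ)).neg
  have := aux_slope (c := (g v).toReal - (g x).toReal) (K := 0) h ?_
  · linarith
  intro t ht ht1
  have h3 := hg_conv x v (1 - t) t (sub_nonneg.mpr ht1) ht.le (by ring)
  have h4 : (1 - t) • x + t • v = x + t • (v - x) := by module
  rw [h4] at h3
  have h5 := hmin (x + t • (v - x))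
  have h6 := h5.trans (add_le_add_right h3 _)
  rw [← EReal.coe_toReal hx (hg_ne_bot x), ← EReal.coe_toReal hv (hg_ne_bot v)] at h6
  norm_cast at h6
  simp only [Pi.neg_apply, zero_smul, add_zero]
  nlinarith

lemma aux_fin {φ : E → ℝ} {g : E → EReal} {x : E} (hg_proper : ∃ x, g x ≠ ⊤)
    (hmin : ∀ v, (φ x : EReal) + g x ≤ φ v + g v) : g x ≠ ⊤ := by
  obtain ⟨v, hv⟩ := hg_proper
  intro h
  have := hmin v
  rw [h, EReal.coe_add_top, top_le_iff] at this
  exact (EReal.add_lt_top (EReal.coe_ne_top _) hv).ne this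

lemma aux_gradsq (u x : E) (γ : ℝ) :
    HasGradientAt (fun v : E => ‖v - u‖ ^ 2 / (2 * γ)) (γ⁻¹ • (x - u)) x := by
  rw [hasGradientAt_iff_hasFDerivAt]
  have h1 : HasFDerivAt (fun v : E => v - u) (ContinuousLinearMap.id ℝ E) x :=
    (hasFDerivAt_id x).sub_const u
  have h2 := (h1.norm_sq).mul_const ((2 * γ)⁻¹)
  simp only [← div_eq_mul_inv] at h2
  refine h2.congr_fderiv ?_
  ext w
  simp [real_inner_smul_left]
  ring

lemma aux_prox {f : E → ℝ} {f' : E → E} {g : E → EReal} {γ : ℝ} (hγ0 : 0 < γ)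
    (hgrad : ∀ x, HasGradientAt f (f' x) x)
    (hg_conv : ∀ x y : E, ∀ a b : ℝ, 0 ≤ a → 0 ≤ b → a + b = 1 →
      g (a • x + b • y) ≤ (a : EReal) * g x + (b : EReal) * g y)
    (hg_ne_bot : ∀ x, g x ≠ ⊥) (hg_proper : ∃ x, g x ≠ ⊤) {xs x u : E}
    (hstar : IsMinOn (fun v => (f v : EReal) + g v) Set.univ xs)
    (hx : IsMinOn (fun v => g v + ((‖v - u‖ ^ 2 / (2 * γ) : ℝ) : EReal)) Set.univ x) :
    ‖x - xs‖ ^ 2 ≤ ‖u - (xs - γ • f' xs)‖ ^ 2 := by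
  have m1 : ∀ v, (f xs : EReal) + g xs ≤ f v + g v := fun v => hstar (Set.mem_univ v)
  have m2 : ∀ v, (((fun v : E => ‖v - u‖ ^ 2 / (2 * γ)) x : ℝ) : EReal) + g x ≤
      ((fun v : E => ‖v - u‖ ^ 2 / (2 * γ)) v : ℝ) + g v := by
    intro v
    have : g x + ((‖x - u‖ ^ 2 / (2 * γ) : ℝ) : EReal) ≤
      g v + ((‖v - u‖ ^ 2 / (2 * γ) : ℝ) : EReal) := hx (Set.mem_univ v)
    rw [add_comm (g x), add_comm (g v)] at this
    exact this
  have f1 := aux_fin hg_proper m1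
  have f2 := aux_fin (φ := fun v : E => ‖v - u‖ ^ 2 / (2 * γ)) hg_proper m2
  have o1 := aux_opt (hgrad xs) hg_conv hg_ne_bot f1 m1 x f2
  have o2 := aux_opt (aux_gradsq u x γ) hg_conv hg_ne_bot f2 m2 xs f1
  rw [real_inner_smul_left] at o2
  have h : 0 ≤ ⟪f' xs, x - xs⟫ + γ⁻¹ * ⟪x - u, xs - x⟫ := by linarith
  have h' := mul_nonneg hγ0.le h
  have e : γ * (⟪f' xs, x - xs⟫ + γ⁻¹ * ⟪x - u, xs - x⟫) =
      ⟪u - (xs - γ • f' xs), x - xs⟫ - ‖x - xs‖ ^ 2 := by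
    have e1 : u - (xs - γ • f' xs) = γ • f' xs + (x - xs) - (x - u) := by abel
    have e2 : xs - x = -(x - xs) := by abel
    rw [mul_add, ← mul_assoc, mul_inv_cancel₀ hγ0.ne', one_mul, e1, e2, inner_neg_right,
      inner_sub_left (γ • f' xs + (x - xs)), inner_add_left, real_inner_smul_left, real_inner_self_eq_norm_sq]
    ring
  rw [e] at h'
  have cs := real_inner_le_norm (u - (xs - γ • f' xs)) (x - xs)
  nlinarith [sq_nonneg (‖u - (xs - γ • f' xs)‖ - ‖x - xs‖)]

lemma aux_proj {R : E →L[ℝ] E} (h1 : ∀ u v : E, ⟪R u, v⟫ = ⟪u, R v⟫)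
    (h2 : ∀ u, R (R u) = R u) (a b : E) :
    ‖a + R (b - a)‖ ^ 2 = ‖a‖ ^ 2 - ⟪a, R a⟫ + ⟪b, R b⟫ := by
  rw [norm_add_sq_real, ← real_inner_self_eq_norm_sq (R (b - a)), h1, h2, map_sub]
  have : ⟪a, R b⟫ = ⟪b, R a⟫ := by rw [← h1, real_inner_comm]
  simp only [inner_sub_left, inner_sub_right]
  linarith
end

theorem statement12
    {n : ℕ} {Ω : Type*} [MeasurableSpace Ω] (μ : Measure Ω) [IsProbabilityMeasure μ]
    (m L γ lam : ℝ)
    (f : EuclideanSpace ℝ (Fin n) → ℝ)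
    (f' : EuclideanSpace ℝ (Fin n) → EuclideanSpace ℝ (Fin n))
    (g : EuclideanSpace ℝ (Fin n) → EReal)
    (hm : 0 < m) (hmL : m ≤ L)
    (hgrad : ∀ x, HasGradientAt f (f' x) x)
    (hsc : StrongConvexOn Set.univ m f)
    (hsmooth : ∀ x y, ‖f' x - f' y‖ ≤ L * ‖x - y‖)
    (hg_conv : ∀ x y : EuclideanSpace ℝ (Fin n), ∀ a b : ℝ, 0 ≤ a → 0 ≤ b → a + b = 1 →
      g (a • x + b • y) ≤ (a : EReal) * g x + (b : EReal) * g y)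
    (hg_ne_bot : ∀ x, g x ≠ ⊥) (hg_proper : ∃ x, g x ≠ ⊤)
    (hg_lsc : LowerSemicontinuous g)
    (hγ0 : 0 < γ) (hγ : γ ≤ 2 / (m + L))
    (xstar : EuclideanSpace ℝ (Fin n))
    (hstar : IsMinOn (fun v => (f v : EReal) + g v) Set.univ xstar)
    (P1 Q1 Q1inv P2 Q2 : EuclideanSpace ℝ (Fin n) →L[ℝ] EuclideanSpace ℝ (Fin n))
    (hP1sym : ∀ u v, ⟪P1 u, v⟫ = ⟪u, P1 v⟫)
    (hP1pos : ∀ v, v ≠ 0 → 0 < ⟪v, P1 v⟫)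
    (hQ1sym : ∀ u v, ⟪Q1 u, v⟫ = ⟪u, Q1 v⟫)
    (hQ1pos : ∀ v, v ≠ 0 → 0 < ⟪v, Q1 v⟫)
    (hQ1QP : ∀ v, Q1 (Q1 (P1 v)) = v)
    (hP1QQ : ∀ v, P1 (Q1 (Q1 v)) = v)
    (hQ1inv : ∀ v, Q1 (Q1inv v) = v)
    (hQ1inv' : ∀ v, Q1inv (Q1 v) = v)
    (hP2sym : ∀ u v, ⟪P2 u, v⟫ = ⟪u, P2 v⟫)
    (hP2pos : ∀ v, v ≠ 0 → 0 < ⟪v, P2 v⟫)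
    (hQ2sym : ∀ u v, ⟪Q2 u, v⟫ = ⟪u, Q2 v⟫)
    (hQ2pos : ∀ v, v ≠ 0 → 0 < ⟪v, Q2 v⟫)
    (hQ2QP : ∀ v, Q2 (Q2 (P2 v)) = v)
    (hP2QQ : ∀ v, P2 (Q2 (Q2 v)) = v)
    (hlam : 0 < lam)
    (hlamP1 : ∀ v, lam * ‖v‖ ^ 2 ≤ ⟪v, P1 v⟫)
    (zstar1 zstar2 : EuclideanSpace ℝ (Fin n))
    (hzstar1 : zstar1 = Q1 (xstar - γ • f' xstar))
    (hzstar2 : zstar2 = Q2 (xstar - γ • f' xstar))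
    (R : Ω → EuclideanSpace ℝ (Fin n) →L[ℝ] EuclideanSpace ℝ (Fin n))
    (hInt : Integrable R μ)
    (hProj : ∀ᵐ ω ∂μ,
      (∀ u v : EuclideanSpace ℝ (Fin n), ⟪R ω u, v⟫ = ⟪u, R ω v⟫) ∧
      (∀ u : EuclideanSpace ℝ (Fin n), R ω (R ω u) = R ω u))
    (hER : (∫ ω, R ω ∂μ) = P1)
    (z x y : EuclideanSpace ℝ (Fin n))
    (hx : IsMinOn (fun v => g v + ((‖v - Q1inv z‖ ^ 2 / (2 * γ) : ℝ) : EReal)) Set.univ x)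
    (hy : y = Q1 (x - γ • f' x)) :
    ∫ ω, ‖Q2 (Q1inv (z + R ω (y - z))) - zstar2‖ ^ 2 ∂μ ≤
      ‖Q2.comp Q1inv‖ ^ 2 * (1 - lam * (2 * γ * m * L / (m + L))) *
        ‖z - zstar1‖ ^ 2 := by
  have hQinvsym : ∀ u v, ⟪Q1inv u, v⟫ = ⟪u, Q1inv v⟫ := by
    intro u v
    have := hQ1sym (Q1inv u) (Q1inv v)
    rw [hQ1inv, hQ1inv] at this
    exact this.symm
  have hP1 : ∀ v, P1 v = Q1inv (Q1inv v) := by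
    intro v
    have := hP1QQ (Q1inv (Q1inv v))
    rwa [hQ1inv, hQ1inv] at this
  have hP1n : ∀ v, ⟪v, P1 v⟫ = ‖Q1inv v‖ ^ 2 := by
    intro v
    rw [hP1, ← hQinvsym, real_inner_self_eq_norm_sq]
  set a := z - zstar1 with ha
  set b := y - zstar1 with hb
  have hbQ : Q1inv b = (x - γ • f' x) - (xstar - γ • f' xstar) := by
    rw [hb, hy, hzstar1, map_sub, hQ1inv', hQ1inv']
  have haQ : Q1inv a = Q1inv z - (xstar - γ • f' xstar) := by
    rw [ha, hzstar1, map_sub, hQ1inv']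
  set c := 2 * γ * m * L / (m + L) with hc
  have hL : 0 < L := hm.trans_le hmL
  have hc0 : 0 ≤ c := by positivity
  have hc1 : c ≤ 1 := by
    have hS : 0 < m + L := by linarith
    have h1 : γ * (m + L) ≤ 2 := by rwa [le_div_iff₀ hS] at hγ
    rw [hc, div_le_one hS]
    have h2 : γ * (m + L) * (m + L) ≤ 2 * (m + L) := by gcongr
    nlinarith [mul_nonneg hγ0.le (sq_nonneg (m - L))]
  have hbb : ⟪b, P1 b⟫ ≤ (1 - c) * ⟪a, P1 a⟫ := by
    rw [hP1n, hP1n, hbQ, haQ]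
    refine (aux_contr hm hmL hγ0 hγ hgrad hsc hsmooth x xstar).trans ?_
    exact mul_le_mul_of_nonneg_left
      (aux_prox hγ0 hgrad hg_conv hg_ne_bot hg_proper hstar hx) (sub_nonneg.mpr hc1)
  have hRi : ∀ v, Integrable (fun ω => R ω v) μ := fun v => hInt.apply_continuousLinearMap v
  have hii : ∀ v, Integrable (fun ω => ⟪v, R ω v⟫) μ := fun v => (hRi v).const_inner v
  have hEi : ∀ v, ∫ ω, ⟪v, R ω v⟫ ∂μ = ⟪v, P1 v⟫ := by
    intro v
    rw [integral_inner (hRi v), ← ContinuousLinearMap.integral_apply hInt, hER]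
  set C := ‖Q2.comp Q1inv‖ with hC
  have hint : Integrable (fun ω => C ^ 2 * (‖a‖ ^ 2 - ⟪a, R ω a⟫ + ⟪b, R ω b⟫)) μ :=
    (((integrable_const _).sub (hii a)).add (hii b)).const_mul _
  have hle : ∀ᵐ ω ∂μ, ‖Q2 (Q1inv (z + R ω (y - z))) - zstar2‖ ^ 2 ≤
      C ^ 2 * (‖a‖ ^ 2 - ⟪a, R ω a⟫ + ⟪b, R ω b⟫) := by
    filter_upwards [hProj] with ω hω
    rw [← aux_proj hω.1 hω.2 a b, ← mul_pow]
    have e : Q2 (Q1inv (z + R ω (y - z))) - zstar2 = (Q2.comp Q1inv) (a + R ω (b - a)) := by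
      have e1 : b - a = y - z := by rw [ha, hb]; abel
      have e2 : a + R ω (y - z) = (z + R ω (y - z)) - zstar1 := by rw [ha]; abel
      have e3 : Q1inv zstar1 = xstar - γ • f' xstar := by rw [hzstar1, hQ1inv']
      rw [e1, e2, ContinuousLinearMap.comp_apply, map_sub Q1inv, map_sub Q2, e3, hzstar2]
    rw [e]
    gcongr
    exact ContinuousLinearMap.le_opNorm _ _
  refine (integral_mono_of_nonneg (Filter.Eventually.of_forall fun ω => by positivity)
    hint hle).trans ?_
  rw [integral_const_mul, integral_add (f := fun ω => ‖a‖ ^ 2 - ⟪a, R ω a⟫)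
      ((integrable_const _).sub (hii a)) (hii b),
    integral_sub (integrable_const _) (hii a), hEi, hEi, integral_const, probReal_univ, one_smul,
    mul_assoc]
  refine mul_le_mul_of_nonneg_left ?_ (sq_nonneg C)
  have := mul_le_mul_of_nonneg_left (hlamP1 a) hc0
  nlinarith
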